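/- arXiv:math/0107160 — 2 statements merged into one kernel-verified Lean document; each statement's English description precedes it below -/
import Mathlib

section
/- Let $f \colon \Delta^n \to \Delta^m$ be given by $f^*(y_j) = \prod_{k=1}^{t_j - t_{j-1}} x_{t_{j-1}+k}$ for $j = 1, \dots, m'$ (with $0 = t_0 < t_1 < \dots < t_{m'} \le n'$, all exponents $1$) and $f^*(y_j) = x_{n'-m'+j}$ for $j = m'+1, \dots, m$. Then every fiber of $f$ is reduced, and $f$ is equi-dimensional of relative dimension $n - m$. -/
open MvPolynomial

/-- The ideal of the fiber over `c` of the weak semistable local model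
`f^*(y_j) = ∏_{k = t_{j-1}+1}^{t_j} x_k` (for `j ≤ m'`, all exponents `1`) and
`f^*(y_j) = x_{n'-m'+j}` (for `j > m'`), in `ℂ[x₁,…,x_n]` (indices `0`-based). -/
noncomputable def fiberIdeal (n m n' m' : ℕ) (hn : 0 < n) (t : ℕ → ℕ) (c : Fin m → ℂ) :
    Ideal (MvPolynomial (Fin n) ℂ) :=
  Ideal.span (Set.range fun j : Fin m =>
    (if (j : ℕ) < m' then
        ∏ i ∈ Finset.Ico (t j) (t ((j : ℕ) + 1)),
          MvPolynomial.X (⟨i % n, Nat.mod_lt _ hn⟩ : Fin n)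
      else MvPolynomial.X (⟨(n' - m' + (j : ℕ)) % n, Nat.mod_lt _ hn⟩ : Fin n))
      - MvPolynomial.C (c j))

theorem dim_eq_of_integral {R S : Type*} [CommRing R] [CommRing S] [Algebra R S] [FaithfulSMul R S]
    [Algebra.IsIntegral R S] : ringKrullDim S = ringKrullDim R := by
  apply le_antisymm
  · refine Order.krullDim_le_of_strictMono (PrimeSpectrum.comap (algebraMap R S)) ?_
    intro a b h
    exact Ideal.IsIntegral.comap_lt_comap (R := R) (I := a.asIdeal) (J := b.asIdeal) h
  · refine iSup_le fun l => ?_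
    obtain ⟨Q, -, hQ, hQ'⟩ := Ideal.exists_ideal_over_prime_of_isIntegral (S := S)
      (RelSeries.head l).asIdeal ⊥ (by
        rw [← RingHom.ker_eq_comap_bot, (RingHom.injective_iff_ker_eq_bot _).1 (FaithfulSMul.algebraMap_injective R S)]
        exact bot_le)
    have : Q.LiesOver (RelSeries.head l).asIdeal := ⟨hQ'.symm⟩
    obtain ⟨L, hL, -⟩ := Ideal.exists_ltSeries_of_hasGoingUp l Q
    rw [← hL]
    exact le_iSup (fun p : LTSeries (PrimeSpectrum S) => (p.length : WithBot ℕ∞)) L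

theorem dim_eq_of_trBasis {B : Type} [CommRing B] [IsDomain B] [Algebra ℂ B] [Algebra.FiniteType ℂ B]
    {κ : Type} [Fintype κ] (x : κ → B) (hx : IsTranscendenceBasis ℂ x) :
    ringKrullDim B = (Fintype.card κ : ℕ) := by
  obtain ⟨s, g, hg, hint⟩ := exists_integral_inj_algHom_of_fg ℂ B
  let : Algebra (MvPolynomial (Fin s) ℂ) B := g.toRingHom.toAlgebra
  have : IsScalarTower ℂ (MvPolynomial (Fin s) ℂ) B := IsScalarTower.of_algHom g
  have : FaithfulSMul (MvPolynomial (Fin s) ℂ) B :=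
    (faithfulSMul_iff_algebraMap_injective _ _).2 hg
  have : Algebra.IsIntegral (MvPolynomial (Fin s) ℂ) B := ⟨hint⟩
  have h1 := (IsTranscendenceBasis.mvPolynomial (Fin s) ℂ).algebraMap_comp (A := B)
  have h2 := hx.cardinalMk_eq h1
  simp at h2
  rw [dim_eq_of_integral (R := MvPolynomial (Fin s) ℂ), MvPolynomial.ringKrullDim_of_isNoetherianRing,
    ringKrullDim_eq_zero_of_field]
  simp [h2]

theorem dim_quot_le {R : Type*} [CommRing R] (I : Ideal R) (d : WithBot ℕ∞)
    (h : ∀ P ∈ I.minimalPrimes, ringKrullDim (R ⧸ P) ≤ d) : ringKrullDim (R ⧸ I) ≤ d := by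
  rw [ringKrullDim_quotient]
  refine iSup_le fun l => ?_
  have h0 : I ≤ (l.head).1.asIdeal := (l.head).2
  obtain ⟨P, hP, hle⟩ := Ideal.exists_minimalPrimes_le h0
  refine le_trans ?_ (h P hP)
  rw [ringKrullDim_quotient]
  let l' : LTSeries (PrimeSpectrum.zeroLocus (R := R) P) :=
    LTSeries.mk l.length (fun i => ⟨(l i).1, fun y hy => by
      have : l.head ≤ l i := LTSeries.head_le l i
      exact this (hle hy)⟩) (fun i j hij => l.strictMono hij)
  exact le_iSup (fun p : LTSeries (PrimeSpectrum.zeroLocus (R := R) P) => (p.length : WithBot ℕ∞)) l'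

section model

set_option linter.unusedSectionVars false

variable {σ ι : Type} [Fintype σ] [DecidableEq σ] [Fintype ι] [DecidableEq ι]

/-- Monomials not divisible by any of the products over the blocks. -/
def NormalExp (S : ι → Finset σ) (b : σ →₀ ℕ) : Prop := ∀ j, ∃ i ∈ S j, b i = 0

/-- Exponent of the Laurent monomial image. -/
def lexp (S : ι → Finset σ) (e : ι → σ) (b : σ →₀ ℕ) : σ → ℤ :=
  fun i => (b i : ℤ) - ∑ j, if i ∈ S j then (b (e j) : ℤ) else 0

/-- Coefficient of the Laurent monomial image. -/
def lcoef (c : ι → ℂ) (e : ι → σ) (b : σ →₀ ℕ) : ℂ := ∏ j, c j ^ b (e j)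

theorem lexp_add (S : ι → Finset σ) (e : ι → σ) (a b : σ →₀ ℕ) :
    lexp S e (a + b) = lexp S e a + lexp S e b := by
  funext i
  simp only [lexp, Finsupp.add_apply, Pi.add_apply, Nat.cast_add]
  have : ∀ j, (if i ∈ S j then (a (e j) : ℤ) + b (e j) else 0) =
      (if i ∈ S j then (a (e j) : ℤ) else 0) + (if i ∈ S j then (b (e j) : ℤ) else 0) := by
    intro j; split_ifs <;> simp
  simp only [this, Finset.sum_add_distrib]
  ring

theorem lcoef_add (c : ι → ℂ) (e : ι → σ) (a b : σ →₀ ℕ) :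
    lcoef c e (a + b) = lcoef c e a * lcoef c e b := by
  simp [lcoef, pow_add, Finset.prod_mul_distrib]

theorem lexp_zero (S : ι → Finset σ) (e : ι → σ) : lexp S e 0 = 0 := by
  funext i; simp [lexp]

/-- The monoid hom underlying the parametrization of a component. -/
noncomputable def lmon (S : ι → Finset σ) (c : ι → ℂ) (e : ι → σ) :
    Multiplicative (σ →₀ ℕ) →* AddMonoidAlgebra ℂ (σ → ℤ) where
  toFun b := AddMonoidAlgebra.single (lexp S e b.toAdd) (lcoef c e b.toAdd)
  map_one' := by
    simp [lexp_zero, lcoef, AddMonoidAlgebra.one_def]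
  map_mul' a b := by
    simp [lexp_add, lcoef_add, AddMonoidAlgebra.single_mul_single]

/-- The parametrization of a component of the fiber. -/
noncomputable def lmap (S : ι → Finset σ) (c : ι → ℂ) (e : ι → σ) :
    MvPolynomial σ ℂ →ₐ[ℂ] AddMonoidAlgebra ℂ (σ → ℤ) :=
  AddMonoidAlgebra.lift ℂ _ (σ →₀ ℕ) (lmon S c e)

theorem lmap_monomial (S : ι → Finset σ) (c : ι → ℂ) (e : ι → σ) (b : σ →₀ ℕ) (r : ℂ) :
    lmap S c e (monomial b r) = AddMonoidAlgebra.single (lexp S e b) (r * lcoef c e b) := by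
  rw [← single_eq_monomial, lmap, AddMonoidAlgebra.lift_single]
  simp [lmon, AddMonoidAlgebra.smul_single]

/-- The ideal of the fiber. -/
noncomputable def modelIdeal (S : ι → Finset σ) (c : ι → ℂ) : Ideal (MvPolynomial σ ℂ) :=
  Ideal.span (Set.range fun j => (∏ i ∈ S j, X i) - C (c j))

theorem prod_X_eq (s : Finset σ) :
    (∏ i ∈ s, X i : MvPolynomial σ ℂ) = monomial (Finsupp.indicator s (fun _ _ => 1)) 1 := by
  have := MvPolynomial.prod_X_pow (R := ℂ) (fun _ : σ => 1) s
  simpa using this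

theorem modelIdeal_le (S : ι → Finset σ) (hd : ∀ j j' i, i ∈ S j → i ∈ S j' → j = j')
    (c : ι → ℂ) (e : ι → σ) (he : ∀ j, e j ∈ S j) :
    modelIdeal S c ≤ RingHom.ker (lmap S c e) := by
  rw [modelIdeal, Ideal.span_le]
  rintro _ ⟨j, rfl⟩
  have key : ∀ j', e j' ∈ S j ↔ j' = j :=
    fun j' => ⟨fun h => hd _ _ _ (he j') h, fun h => h ▸ he j'⟩
  have h1 : lexp S e (Finsupp.indicator (S j) (fun _ _ => 1)) = 0 := by
    funext i
    simp only [lexp, Finsupp.indicator_apply, dite_eq_ite, key]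
    have : ∀ j', (if i ∈ S j' then (((if j' = j then 1 else 0 : ℕ)) : ℤ) else 0) =
      if j' = j then (if i ∈ S j then 1 else 0) else 0 := by
      intro j'; by_cases h : j' = j
      · subst h; simp
      · simp [h]
    simp only [this]
    simp
  have h2 : lcoef c e (Finsupp.indicator (S j) (fun _ _ => 1)) = c j := by
    simp only [lcoef, Finsupp.indicator_apply, dite_eq_ite, key]
    have : ∀ j', c j' ^ (if j' = j then 1 else 0) = if j' = j then c j else 1 := by
      intro j'; by_cases h : j' = j
      · subst h; simp
      · simp [h]
    simp only [this]
    simp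
  simp only [SetLike.mem_coe, RingHom.mem_ker, map_sub, prod_X_eq]
  rw [C_apply, lmap_monomial, lmap_monomial, h1, h2, lexp_zero]
  simp [lcoef]

theorem lmap_ne_zero (S : ι → Finset σ) (hd : ∀ j j' i, i ∈ S j → i ∈ S j' → j = j')
    (c : ι → ℂ) (e : ι → σ) (p : MvPolynomial σ ℂ)
    (hp : ∀ b ∈ p.support, NormalExp S b) (a : σ →₀ ℕ) (ha : a ∈ p.support)
    (hae : ∀ j, a (e j) = 0) : lmap S c e p ≠ 0 := by
  have hval : ∀ (b : σ →₀ ℕ) (j : ι) (i : σ), i ∈ S j → lexp S e b i = b i - b (e j) := by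
    intro b j i hi
    simp only [lexp]
    congr 1
    rw [Finset.sum_eq_single j]
    · simp [hi]
    · intro j' _ hj'
      rw [if_neg]
      exact fun h => hj' (hd _ _ _ h hi)
    · simp
  have huniq : ∀ b ∈ p.support, lexp S e b = lexp S e a → b = a := by
    intro b hb hba
    have hbe : ∀ j, b (e j) = 0 := by
      intro j
      obtain ⟨i, hi, hbi⟩ := hp b hb j
      have := congrFun hba i
      rw [hval b j i hi, hval a j i hi, hae j, hbi] at this
      push_cast at this
      omega
    ext i
    by_cases h : ∃ j, i ∈ S j
    · obtain ⟨j, hi⟩ := h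
      have := congrFun hba i
      rw [hval b j i hi, hval a j i hi, hae j, hbe j] at this
      push_cast at this
      omega
    · have := congrFun hba i
      push Not at h
      simp only [lexp, h, if_false, Finset.sum_const_zero] at this
      omega
  intro h0
  have h1 : (lmap S c e p).coeff (lexp S e a) = MvPolynomial.coeff a p := by
    conv_lhs => rw [p.as_sum, map_sum]
    simp only [lmap_monomial, AddMonoidAlgebra.coeff_sum, AddMonoidAlgebra.coeff_single,
      Finsupp.finsetSum_apply]
    rw [Finset.sum_eq_single a]
    · simp [lcoef, hae]
    · intro b hb hba
      rw [Finsupp.single_apply, if_neg]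
      exact fun h => hba (huniq b hb h)
    · exact fun h => absurd ha h
  rw [h0] at h1
  exact (MvPolynomial.mem_support_iff.1 ha) (by rw [← h1]; rfl)

theorem exists_normal_monomial (S : ι → Finset σ) (hne : ∀ j, (S j).Nonempty) (c : ι → ℂ) (d : ℕ) :
    ∀ (b : σ →₀ ℕ) (r : ℂ), b.degree = d →
    ∃ q : MvPolynomial σ ℂ, (∀ a ∈ q.support, NormalExp S a) ∧
      monomial b r - q ∈ modelIdeal S c := by
  induction d using Nat.strong_induction_on with
  | _ d ih =>
  intro b r hbd
  by_cases hb : NormalExp S b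
  · refine ⟨monomial b r, ?_, by simp⟩
    intro a ha
    have := MvPolynomial.support_monomial_subset ha
    rw [Finset.mem_singleton] at this
    rwa [this]
  · simp only [NormalExp] at hb
    push Not at hb
    obtain ⟨j, hj⟩ := hb
    set s : σ →₀ ℕ := Finsupp.indicator (S j) (fun _ _ => 1) with hs
    have hle : s ≤ b := by
      intro i
      simp only [hs, Finsupp.indicator_apply, dite_eq_ite]
      split_ifs with h
      · exact Nat.one_le_iff_ne_zero.2 (hj i h)
      · exact Nat.zero_le _
    obtain ⟨b', rfl⟩ := exists_add_of_le hle
    have hpos : 0 < s.degree := by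
      obtain ⟨i, hi⟩ := hne j
      have h1 : s i ≤ s.degree := Finsupp.le_degree i s
      have h2 : s i = 1 := by simp [hs, hi]
      omega
    rw [map_add] at hbd
    obtain ⟨q, hq, hq'⟩ := ih b'.degree (by omega) b' (c j * r) rfl
    refine ⟨q, hq, ?_⟩
    have h3 : (monomial (s + b') r : MvPolynomial σ ℂ) - q =
        monomial b' r * ((∏ i ∈ S j, X i) - C (c j)) + (monomial b' (c j * r) - q) := by
      rw [prod_X_eq, mul_sub, mul_comm _ (C (c j)), C_mul_monomial, monomial_mul, mul_one,
        add_comm s b']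
      ring
    rw [h3]
    exact Ideal.add_mem _ (Ideal.mul_mem_left _ _ (Ideal.subset_span ⟨j, rfl⟩)) hq'

theorem exists_normal (S : ι → Finset σ) (hne : ∀ j, (S j).Nonempty) (c : ι → ℂ)
    (p : MvPolynomial σ ℂ) :
    ∃ q : MvPolynomial σ ℂ, (∀ a ∈ q.support, NormalExp S a) ∧ p - q ∈ modelIdeal S c := by
  induction p using MvPolynomial.induction_on' with
  | monomial u a => exact exists_normal_monomial S hne c u.degree u a rfl
  | add p q hp hq =>
    obtain ⟨p', hp', hpI⟩ := hp
    obtain ⟨q', hq', hqI⟩ := hq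
    refine ⟨p' + q', fun a ha => ?_, ?_⟩
    · rcases Finset.mem_union.1 (MvPolynomial.support_add ha) with h | h
      · exact hp' a h
      · exact hq' a h
    · have h := Ideal.add_mem _ hpI hqI
      rwa [sub_add_sub_comm] at h

theorem modelIdeal_eq (S : ι → Finset σ) (hne : ∀ j, (S j).Nonempty)
    (hd : ∀ j j' i, i ∈ S j → i ∈ S j' → j = j') (c : ι → ℂ) :
    modelIdeal S c =
      Finset.univ.inf (fun e : {e : ι → σ // ∀ j, e j ∈ S j} => RingHom.ker (lmap S c e.1)) := by
  apply le_antisymm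
  · exact Finset.le_inf fun e _ => modelIdeal_le S hd c e.1 e.2
  · intro p hp
    rw [Submodule.mem_finsetInf] at hp
    obtain ⟨q, hq, hpq⟩ := exists_normal S hne c p
    have hq0 : q = 0 := by
      by_contra hq0
      obtain ⟨a, ha⟩ := Finset.nonempty_iff_ne_empty.2 (mt MvPolynomial.support_eq_empty.1 hq0)
      choose e he hae using hq a ha
      refine lmap_ne_zero S hd c e q hq a ha hae ?_
      have h1 : p ∈ RingHom.ker (lmap S c e) := hp ⟨e, he⟩ (Finset.mem_univ _)
      have h2 := modelIdeal_le S hd c e he hpq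
      rw [RingHom.mem_ker] at h1 h2
      rw [map_sub, h1, zero_sub, neg_eq_zero] at h2
      exact h2
    rw [hq0, sub_zero] at hpq
    exact hpq

theorem dim_component (S : ι → Finset σ) (hd : ∀ j j' i, i ∈ S j → i ∈ S j' → j = j')
    (c : ι → ℂ) (e : ι → σ) (he : ∀ j, e j ∈ S j) :
    ringKrullDim (MvPolynomial σ ℂ ⧸ RingHom.ker (lmap S c e)) =
      (Fintype.card σ - Fintype.card ι : ℕ) := by
  set Q := RingHom.ker (lmap S c e) with hQ
  have hprime : Q.IsPrime := RingHom.ker_isPrime _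
  let κ := {i : σ // i ∉ Set.range e}
  have : Fintype κ := Fintype.ofFinite κ
  have heinj : Function.Injective e := fun j j' h => hd _ _ _ (he j) (h ▸ he j')
  have hcard : Fintype.card κ = Fintype.card σ - Fintype.card ι := by
    have h1 : Fintype.card κ = Fintype.card σ - Fintype.card {i : σ // i ∈ Set.range e} :=
      Fintype.card_subtype_compl (fun i => i ∈ Set.range e)
    rw [h1]
    congr 1
    exact (Fintype.card_congr (Equiv.ofInjective e heinj)).symm
  let x : κ → MvPolynomial σ ℂ ⧸ Q := fun k => Ideal.Quotient.mk Q (X k.1)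
  have hind : AlgebraicIndependent ℂ x := by
    rw [algebraicIndependent_iff]
    intro p hp
    have h1 : aeval x p = Ideal.Quotient.mkₐ ℂ Q (rename Subtype.val p) := by
      rw [← AlgHom.comp_apply]
      congr 1
      ext k
      simp [x]
    rw [h1] at hp
    have h2 : lmap S c e (rename Subtype.val p) = 0 := Ideal.Quotient.eq_zero_iff_mem.1 hp
    have hinj : Function.Injective (rename (R := ℂ) (Subtype.val : κ → σ)) :=
      rename_injective _ Subtype.val_injective
    by_contra hp0
    have hq0 : rename (Subtype.val : κ → σ) p ≠ 0 := fun h => hp0 (hinj (by rw [h, map_zero]))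
    have hz : ∀ b ∈ (rename (Subtype.val : κ → σ) p).support, ∀ j, b (e j) = 0 := by
      intro b hb j
      by_contra hbj
      have h3 : e j ∈ (rename (Subtype.val : κ → σ) p).vars :=
        (mem_vars_iff_mem_support _).2 ⟨b, hb, Finsupp.mem_support_iff.2 hbj⟩
      have h4 := vars_rename _ _ h3
      rw [Finset.mem_image] at h4
      obtain ⟨k, -, hk⟩ := h4
      exact k.2 ⟨j, hk.symm⟩
    obtain ⟨a, ha⟩ := Finset.nonempty_iff_ne_empty.2 (mt MvPolynomial.support_eq_empty.1 hq0)
    exact lmap_ne_zero S hd c e _ (fun b hb j => ⟨e j, he j, hz b hb j⟩) a ha (hz a ha) h2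
  have hxne : ∀ k, x k ≠ 0 := fun k => hind.ne_zero k
  have halg : Algebra.IsAlgebraic (Algebra.adjoin ℂ (Set.range x)) (MvPolynomial σ ℂ ⧸ Q) := by
    have hmem : ∀ k, x k ∈ Algebra.adjoin ℂ (Set.range x) :=
      fun k => Algebra.subset_adjoin ⟨k, rfl⟩
    have hX : ∀ i, IsAlgebraic (Algebra.adjoin ℂ (Set.range x)) (Ideal.Quotient.mk Q (X i)) := by
      intro i
      by_cases hi : i ∈ Set.range e
      · obtain ⟨j, rfl⟩ := hi
        have hk : ∀ i ∈ (S j).erase (e j), i ∉ Set.range e := by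
          rintro _ hi ⟨j', rfl⟩
          rw [Finset.mem_erase] at hi
          exact hi.1 (congrArg e (hd _ _ _ (he j') hi.2))
        set u : MvPolynomial σ ℂ ⧸ Q := ∏ i ∈ (S j).erase (e j), Ideal.Quotient.mk Q (X i) with hu
        have humem : u ∈ Algebra.adjoin ℂ (Set.range x) :=
          Subalgebra.prod_mem _ fun i hi => hmem ⟨i, hk i hi⟩
        have hune : u ≠ 0 := Finset.prod_ne_zero_iff.2 fun i hi => hxne ⟨i, hk i hi⟩
        have hrel : Ideal.Quotient.mk Q (X (e j)) * u = algebraMap ℂ _ (c j) := by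
          have h1 : (∏ i ∈ S j, X i) - C (c j) ∈ Q :=
            modelIdeal_le S hd c e he (Ideal.subset_span ⟨j, rfl⟩)
          rw [← Finset.mul_prod_erase _ _ (he j)] at h1
          have h2 := Ideal.Quotient.eq.2 h1
          rw [map_mul, map_prod] at h2
          exact h2
        refine ⟨Polynomial.C ⟨u, humem⟩ * Polynomial.X -
          Polynomial.C (algebraMap ℂ _ (c j)), ?_, ?_⟩
        · intro h
          have := congrArg (fun q => Polynomial.coeff q 1) h
          simp [Polynomial.coeff_C] at this
          exact hune (congrArg Subtype.val this)
        · simp only [map_sub, map_mul, Polynomial.aeval_C, Polynomial.aeval_X]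
          rw [← IsScalarTower.algebraMap_apply, ← hrel, mul_comm]
          exact sub_self _
      · exact isAlgebraic_algebraMap (⟨x ⟨i, hi⟩, hmem _⟩ : Algebra.adjoin ℂ (Set.range x))
    constructor
    intro y
    obtain ⟨p, rfl⟩ := Ideal.Quotient.mk_surjective y
    induction p using MvPolynomial.induction_on with
    | C a => exact isAlgebraic_algebraMap (algebraMap ℂ (Algebra.adjoin ℂ (Set.range x)) a)
    | add p q hp hq => rw [map_add]; exact hp.add hq
    | mul_X p i hp => rw [map_mul]; exact hp.mul (hX i)
  rw [dim_eq_of_trBasis x (hind.isTranscendenceBasis_iff_isAlgebraic.2 halg), hcard]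

theorem model_main (S : ι → Finset σ) (hne : ∀ j, (S j).Nonempty)
    (hd : ∀ j j' i, i ∈ S j → i ∈ S j' → j = j') (c : ι → ℂ) :
    (modelIdeal S c).IsRadical ∧
    ringKrullDim (MvPolynomial σ ℂ ⧸ modelIdeal S c) = (Fintype.card σ - Fintype.card ι : ℕ) ∧
    (∀ P ∈ (modelIdeal S c).minimalPrimes,
      ringKrullDim (MvPolynomial σ ℂ ⧸ P) = (Fintype.card σ - Fintype.card ι : ℕ)) := by
  have hprime : ∀ e, (RingHom.ker (lmap S c e)).IsPrime := fun e => RingHom.ker_isPrime _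
  have hmin : ∀ P ∈ (modelIdeal S c).minimalPrimes,
      ringKrullDim (MvPolynomial σ ℂ ⧸ P) = (Fintype.card σ - Fintype.card ι : ℕ) := by
    intro P hP
    have hPp : P.IsPrime := hP.1.1
    have h1 : modelIdeal S c ≤ P := hP.1.2
    rw [modelIdeal_eq S hne hd c, hPp.inf_le'] at h1
    obtain ⟨e, -, he⟩ := h1
    have h2 : P = RingHom.ker (lmap S c e.1) :=
      le_antisymm (hP.2 ⟨hprime e.1, modelIdeal_le S hd c e.1 e.2⟩ he) he
    rw [h2]
    exact dim_component S hd c e.1 e.2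
  refine ⟨?_, le_antisymm ?_ ?_, hmin⟩
  · rintro p ⟨k, hk⟩
    rw [modelIdeal_eq S hne hd c, Submodule.mem_finsetInf] at hk ⊢
    exact fun e he => (hprime e.1).mem_of_pow_mem k (hk e he)
  · exact dim_quot_le _ _ fun P hP => (hmin P hP).le
  · choose e he using hne
    rw [← dim_component S hd c e he]
    exact ringKrullDim_le_of_surjective
      (Ideal.Quotient.factor (modelIdeal_le S hd c e he)) (Ideal.Quotient.factor_surjective _)

end model

/-- Every fiber of the weak semistable local model is reduced, and the morphism is
equi-dimensional of relative dimension `n - m`: the fiber ideal is radical, the fiber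
has Krull dimension `n - m`, and every irreducible component (minimal prime) of the
fiber has dimension `n - m`. -/
theorem weak_semistable_fibers_reduced_equidimensional
    (n m n' m' : ℕ) (hn : 0 < n) (hn'n : n' ≤ n) (hm'm : m' ≤ m) (hm'n' : m' ≤ n')
    (hlast : n' + m ≤ n + m')
    (t : ℕ → ℕ) (ht0 : t 0 = 0) (htmono : StrictMonoOn t (Set.Iic m'))
    (htn' : t m' ≤ n') (c : Fin m → ℂ) :
    (fiberIdeal n m n' m' hn t c).IsRadical ∧
    ringKrullDim (MvPolynomial (Fin n) ℂ ⧸ fiberIdeal n m n' m' hn t c) = (n - m : ℕ) ∧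
    (∀ P ∈ (fiberIdeal n m n' m' hn t c).minimalPrimes,
      ringKrullDim (MvPolynomial (Fin n) ℂ ⧸ P) = (n - m : ℕ)) := by
  have hmono : ∀ a b, a ≤ b → b ≤ m' → t a ≤ t b := fun a b hab hb =>
    htmono.monotoneOn (Set.mem_Iic.2 (hab.trans hb)) (Set.mem_Iic.2 hb) hab
  let S : Fin m → Finset (Fin n) := fun j =>
    if (j : ℕ) < m' then Finset.univ.filter fun i => t j ≤ (i : ℕ) ∧ (i : ℕ) < t ((j : ℕ) + 1)
    else {⟨(n' - m' + (j : ℕ)) % n, Nat.mod_lt _ hn⟩}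
  have hmod : ∀ j : Fin m, ¬ (j : ℕ) < m' → (n' - m' + (j : ℕ)) % n = n' - m' + (j : ℕ) := by
    intro j hj
    apply Nat.mod_eq_of_lt
    have := j.2
    omega
  have hI : fiberIdeal n m n' m' hn t c = modelIdeal S c := by
    rw [fiberIdeal, modelIdeal]
    congr 2
    funext j
    congr 1
    by_cases hj : (j : ℕ) < m'
    · have hle : t ((j : ℕ) + 1) ≤ n := (hmono _ m' hj le_rfl).trans (htn'.trans hn'n)
      simp only [S, if_pos hj]
      symm
      refine Finset.prod_bij (fun (i : Fin n) _ => (i : ℕ)) ?_ ?_ ?_ ?_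
      · intro i hi
        simpa using hi
      · intro i _ i' _ h
        exact Fin.ext h
      · intro i hi
        rw [Finset.mem_Ico] at hi
        exact ⟨⟨i, by omega⟩, by simpa using hi, rfl⟩
      · intro i _
        congr 1
        exact Fin.ext (Nat.mod_eq_of_lt i.2).symm
    · simp only [S, if_neg hj, Finset.prod_singleton]
  have hmem1 : ∀ (j : Fin m) (i : Fin n), (j : ℕ) < m' → i ∈ S j →
      t j ≤ (i : ℕ) ∧ (i : ℕ) < t ((j : ℕ) + 1) := by
    intro j i hj hi
    simpa only [S, if_pos hj, Finset.mem_filter, Finset.mem_univ, true_and] using hi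
  have hmem2 : ∀ (j : Fin m) (i : Fin n), ¬ (j : ℕ) < m' → i ∈ S j →
      (i : ℕ) = n' - m' + (j : ℕ) := by
    intro j i hj hi
    simp only [S, if_neg hj, Finset.mem_singleton] at hi
    exact (congrArg Fin.val hi).trans (hmod j hj)
  have hne : ∀ j, (S j).Nonempty := by
    intro j
    by_cases hj : (j : ℕ) < m'
    · have hle : t ((j : ℕ) + 1) ≤ n := (hmono _ m' hj le_rfl).trans (htn'.trans hn'n)
      have hlt : t j < t ((j : ℕ) + 1) :=
        htmono (Set.mem_Iic.2 hj.le) (Set.mem_Iic.2 hj) (Nat.lt_succ_self _)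
      refine ⟨⟨t j, by omega⟩, ?_⟩
      simp only [S, if_pos hj, Finset.mem_filter, Finset.mem_univ, true_and]
      exact ⟨le_rfl, hlt⟩
    · simp only [S, if_neg hj]
      exact Finset.singleton_nonempty _
  have hd : ∀ j j' i, i ∈ S j → i ∈ S j' → j = j' := by
    intro j j' i hi hi'
    by_cases hj : (j : ℕ) < m'
    · have h1 := hmem1 j i hj hi
      have h1n := hmono ((j : ℕ) + 1) m' hj le_rfl
      by_cases hj' : (j' : ℕ) < m'
      · have h2 := hmem1 j' i hj' hi'
        rcases lt_trichotomy (j : ℕ) j' with h | h | h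
        · have := hmono ((j : ℕ) + 1) j' h hj'.le
          omega
        · exact Fin.ext h
        · have := hmono ((j' : ℕ) + 1) j h hj.le
          omega
      · have h2 := hmem2 j' i hj' hi'
        omega
    · have h1 := hmem2 j i hj hi
      by_cases hj' : (j' : ℕ) < m'
      · have h2 := hmem1 j' i hj' hi'
        have h2n := hmono ((j' : ℕ) + 1) m' hj' le_rfl
        omega
      · have h2 := hmem2 j' i hj' hi'
        exact Fin.ext (by omega)
  have main := model_main S hne hd c
  rw [← hI] at main
  simpa only [Fintype.card_fin] using main
end

section
/- With $D$ as in the previous statement, $D$ is surjective: for every $h \in \mathcal{O}_2[T_1, T_2]$ there exists $g \in \mathcal{O}_2[T_1, T_2]$ such that $D(g) = h$. -/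
open Filter

namespace RLP

/-- the Euler type operator -/
noncomputable def E (a : ℂ × ℂ → ℂ) (z : ℂ × ℂ) : ℂ :=
  z.1 * deriv (fun w => a (w, z.2)) z.1 - z.2 * deriv (fun w => a (z.1, w)) z.2

/-- the operator D -/
noncomputable def Dop (g : ℕ → ℕ → ℂ × ℂ → ℂ) (k l : ℕ) (z : ℂ × ℂ) : ℂ :=
  E (g k l) z + ((k : ℂ) + 1) * g (k + 1) l z - ((l : ℂ) + 1) * g k (l + 1) z

/-- admissible families -/
def Adm (g : ℕ → ℕ → ℂ × ℂ → ℂ) : Prop :=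
  (∃ N, ∀ k₁ k₂, N ≤ k₁ ∨ N ≤ k₂ → g k₁ k₂ = 0) ∧ (∀ k₁ k₂, AnalyticAt ℂ (g k₁ k₂) 0)

/-- being in the image of D -/
def P (h : ℕ → ℕ → ℂ × ℂ → ℂ) : Prop :=
  ∃ g, Adm g ∧ ∀ k l, Dop g k l =ᶠ[nhds (0 : ℂ × ℂ)] h k l

lemma E_add {a b : ℂ × ℂ → ℂ} (ha : AnalyticAt ℂ a 0) (hb : AnalyticAt ℂ b 0) :
    E (a + b) =ᶠ[nhds 0] E a + E b := by
  filter_upwards [ha.eventually_analyticAt, hb.eventually_analyticAt] with z h1 h2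
  have d1 := h1.differentiableAt
  have d2 := h2.differentiableAt
  have e1 : DifferentiableAt ℂ (fun w => a (w, z.2)) z.1 :=
    DifferentiableAt.comp (g := a) (f := fun w => (w, z.2)) z.1 d1 (by fun_prop)
  have e2 : DifferentiableAt ℂ (fun w => b (w, z.2)) z.1 :=
    DifferentiableAt.comp (g := b) (f := fun w => (w, z.2)) z.1 d2 (by fun_prop)
  have e3 : DifferentiableAt ℂ (fun w => a (z.1, w)) z.2 :=
    DifferentiableAt.comp (g := a) (f := fun w => (z.1, w)) z.2 d1 (by fun_prop)
  have e4 : DifferentiableAt ℂ (fun w => b (z.1, w)) z.2 :=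
    DifferentiableAt.comp (g := b) (f := fun w => (z.1, w)) z.2 d2 (by fun_prop)
  simp only [E, Pi.add_apply]
  rw [deriv_fun_add e1 e2, deriv_fun_add e3 e4]
  ring

lemma E_smul (c : ℂ) (a : ℂ × ℂ → ℂ) : E (c • a) = c • E a := by
  funext z
  simp only [E, Pi.smul_apply, smul_eq_mul, deriv_const_mul_field']
  ring

lemma E_zero : E 0 = 0 := by
  funext z
  simp [E]

lemma Adm.add {g g' : ℕ → ℕ → ℂ × ℂ → ℂ} (h : Adm g) (h' : Adm g') : Adm (g + g') := by
  obtain ⟨⟨N, hN⟩, ha⟩ := h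
  obtain ⟨⟨M, hM⟩, hb⟩ := h'
  refine ⟨⟨max N M, fun k l hkl => ?_⟩, fun k l => (ha k l).add (hb k l)⟩
  have h1 := hN k l (by omega)
  have h2 := hM k l (by omega)
  simp [h1, h2]

lemma P.step {g h h' : ℕ → ℕ → ℂ × ℂ → ℂ} (hg : Adm g) (hp : P h')
    (e : ∀ k l, Dop g k l + h' k l =ᶠ[nhds 0] h k l) : P h := by
  obtain ⟨f, hf, hfe⟩ := hp
  refine ⟨g + f, hg.add hf, fun k l => ?_⟩
  filter_upwards [e k l, hfe k l, E_add (hg.2 k l) (hf.2 k l)] with z h1 h2 h3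
  rw [← h1, Pi.add_apply, ← h2]
  simp only [Dop, Pi.add_apply] at h3 ⊢
  rw [h3]
  ring

lemma P.zero : P 0 := by
  refine ⟨0, ⟨⟨0, fun _ _ _ => rfl⟩, fun _ _ => analyticAt_const⟩, fun k l => ?_⟩
  refine Eventually.of_forall fun z => ?_
  simp [Dop, E_zero]

lemma P.add {h h' : ℕ → ℕ → ℂ × ℂ → ℂ} (hp : P h) (hp' : P h') : P (h + h') := by
  obtain ⟨g, hg, e⟩ := hp
  exact P.step hg hp' fun k l => (e k l).add (EventuallyEq.refl _ _)

/-- monomials -/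
noncomputable def mono (i j : ℕ) (a : ℂ × ℂ → ℂ) : ℕ → ℕ → ℂ × ℂ → ℂ :=
  fun k l => if k = i ∧ l = j then a else 0

lemma mono_adm (i j : ℕ) {a : ℂ × ℂ → ℂ} (ha : AnalyticAt ℂ a 0) : Adm (mono i j a) := by
  refine ⟨⟨i + j + 1, fun k l hkl => ?_⟩, fun k l => ?_⟩
  · rw [mono, if_neg (by omega)]
  · unfold mono
    split_ifs
    · exact ha
    · exact analyticAt_const

lemma Dop_mono (i j : ℕ) (b : ℂ × ℂ → ℂ) :
    Dop (mono i j b) = mono i j (E b) + mono (i - 1) j ((i : ℂ) • b)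
      + mono i (j - 1) (-(j : ℂ) • b) := by
  funext k l z
  have h1 : E (mono i j b k l) z = mono i j (E b) k l z := by
    unfold mono
    split_ifs
    · rfl
    · rw [E_zero]
  have h2 : ((k : ℂ) + 1) * mono i j b (k + 1) l z = mono (i - 1) j ((i : ℂ) • b) k l z := by
    unfold mono
    rcases i with _ | i
    · simp
    · by_cases h : k = i ∧ l = j <;> simp [h]
  have h3 : ((l : ℂ) + 1) * mono i j b k (l + 1) z = - mono i (j - 1) (-(j : ℂ) • b) k l z := by
    unfold mono
    rcases j with _ | j
    · simp
    · by_cases h : k = i ∧ l = j <;> simp [h] <;> ring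
  simp only [Dop, Pi.add_apply, h1, h2, h3]
  ring

lemma P_diag (j : ℕ) : ∀ (i : ℕ) (a : ℂ × ℂ → ℂ), AnalyticAt ℂ a 0 → E a =ᶠ[nhds 0] 0 →
    P (mono i j a) := by
  induction j with
  | zero =>
    intro i a ha he
    have hi : (i : ℂ) + 1 ≠ 0 := by exact_mod_cast Nat.succ_ne_zero i
    refine P.step (g := mono (i + 1) 0 (((i : ℂ) + 1)⁻¹ • a))
      (mono_adm _ _ (ha.const_smul)) P.zero fun k l => ?_
    rw [Dop_mono]
    filter_upwards [he] with z hz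
    simp only [E_smul, mono, Pi.add_apply, Pi.zero_apply]
    by_cases h1 : k = i <;> by_cases h2 : l = 0 <;> by_cases h3 : k = i + 1 <;>
      simp [h1, h2, h3, hz, hi]
  | succ j ih =>
    intro i a ha he
    have hi : (i : ℂ) + 1 ≠ 0 := by exact_mod_cast Nat.succ_ne_zero i
    refine P.step (g := mono (i + 1) (j + 1) (((i : ℂ) + 1)⁻¹ • a))
      (mono_adm _ _ (ha.const_smul))
      (ih (i + 1) ((((j : ℂ) + 1) * ((i : ℂ) + 1)⁻¹) • a) ha.const_smul ?_) fun k l => ?_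
    · rw [E_smul]
      filter_upwards [he] with z hz
      simp [hz]
    rw [Dop_mono]
    filter_upwards [he] with z hz
    simp only [E_smul, mono, Pi.add_apply, Nat.add_sub_cancel]
    have q1 : (if k = i + 1 ∧ l = j + 1 then ((i : ℂ) + 1)⁻¹ • E a else 0) z = 0 := by
      split_ifs <;> simp [hz]
    have q2 : ((((i + 1 : ℕ) : ℂ)) • ((i : ℂ) + 1)⁻¹ • a) = a := by
      rw [smul_smul]; push_cast; rw [mul_inv_cancel₀ hi, one_smul]
    rw [q1, q2]
    by_cases h : k = i + 1 ∧ l = j <;> simp [h] <;> ring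

/-- the rotation -/
noncomputable def R (t : ℝ) : ℂ × ℂ →L[ℂ] ℂ × ℂ :=
  (Complex.exp (t * Complex.I) • ContinuousLinearMap.fst ℂ ℂ ℂ).prod
    (Complex.exp (-(t * Complex.I)) • ContinuousLinearMap.snd ℂ ℂ ℂ)

lemma R_apply (t : ℝ) (z : ℂ × ℂ) :
    R t z = (Complex.exp (t * Complex.I) * z.1, Complex.exp (-(t * Complex.I)) * z.2) := rfl

lemma R_R (s t : ℝ) (z : ℂ × ℂ) : R s (R t z) = R (s + t) z := by
  simp only [R_apply, ← mul_assoc, ← Complex.exp_add]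
  push_cast
  congr 3 <;> ring_nf

lemma norm_R_apply (t : ℝ) (z : ℂ × ℂ) : ‖R t z‖ = ‖z‖ := by
  have h2 : ‖Complex.exp (-(t * Complex.I))‖ = 1 := by
    have := Complex.norm_exp_ofReal_mul_I (-t)
    rwa [Complex.ofReal_neg, neg_mul] at this
  simp only [R_apply, Prod.norm_def, norm_mul, Complex.norm_exp_ofReal_mul_I, h2, one_mul]

lemma norm_R_le (t : ℝ) : ‖R t‖ ≤ 1 :=
  ContinuousLinearMap.opNorm_le_bound _ zero_le_one fun z => by rw [norm_R_apply, one_mul]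

lemma R_two_pi (t : ℝ) : R (t + 2 * Real.pi) = R t := by
  ext <;> simp [R, add_mul, Complex.exp_add, Complex.exp_neg]

lemma continuous_R : Continuous R := by
  have : Continuous fun t : ℝ => ((Complex.exp (t * Complex.I)) •
      ((ContinuousLinearMap.inl ℂ ℂ ℂ).comp (ContinuousLinearMap.fst ℂ ℂ ℂ))
     + (Complex.exp (-(t * Complex.I))) •
      ((ContinuousLinearMap.inr ℂ ℂ ℂ).comp (ContinuousLinearMap.snd ℂ ℂ ℂ)) :
      ℂ × ℂ →L[ℂ] ℂ × ℂ) := by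
    fun_prop
  convert this using 2 with t
  ext <;> simp [R]

/-- weighted rotation averages -/
noncomputable def Av (w : ℝ → ℂ) (a : ℂ × ℂ → ℂ) (z : ℂ × ℂ) : ℂ :=
  ∫ t in (0 : ℝ)..(2 * Real.pi), w t * a (R t z)

lemma integral_apply {n : ℕ} {G : ℝ → ContinuousMultilinearMap ℂ (fun _ : Fin n => ℂ × ℂ) ℂ}
    (hG : Continuous G) (c d : ℝ) (v : Fin n → ℂ × ℂ) :
    (∫ t in c..d, G t) v = ∫ t in c..d, G t v := by
  have hi : IntervalIntegrable G MeasureTheory.volume c d := hG.intervalIntegrable c d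
  have := (ContinuousMultilinearMap.apply ℂ (fun _ : Fin n => ℂ × ℂ) ℂ
    v).intervalIntegral_comp_comm hi
  exact this.symm

lemma R_mem {r : ENNReal} {y : ℂ × ℂ} (t : ℝ) (hy : y ∈ Metric.eball (0 : ℂ × ℂ) r) :
    R t y ∈ Metric.eball (0 : ℂ × ℂ) r := by
  rw [Metric.mem_eball, edist_zero_right, ← ofReal_norm] at hy ⊢
  rwa [norm_R_apply]

set_option maxHeartbeats 1000000 in
lemma Av_analytic {w : ℝ → ℂ} (hw : Continuous w) {a : ℂ × ℂ → ℂ}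
    (ha : AnalyticAt ℂ a 0) : AnalyticAt ℂ (Av w a) 0 := by
  obtain ⟨p, r, hp⟩ := ha
  obtain ⟨C, hC⟩ : ∃ C, ∀ t ∈ Set.Icc 0 (2 * Real.pi), ‖w t‖ ≤ C :=
    isCompact_Icc.exists_bound_of_continuousOn hw.continuousOn
  have hpi : (0 : ℝ) ≤ 2 * Real.pi := by positivity
  have hC' : ∀ t ∈ Set.uIoc 0 (2 * Real.pi), ‖w t‖ ≤ C := fun t ht => by
    rw [Set.uIoc_of_le hpi] at ht
    exact hC t ⟨ht.1.le, ht.2⟩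
  have hC0 : 0 ≤ C := (norm_nonneg _).trans (hC 0 ⟨le_rfl, hpi⟩)
  let F : ∀ n : ℕ, ℝ → ContinuousMultilinearMap ℂ (fun _ : Fin n => ℂ × ℂ) ℂ :=
    fun n t => w t • (p n).compContinuousLinearMap (fun _ => R t)
  have hF : ∀ n, Continuous (F n) := fun n => by
    refine hw.smul ?_
    have h1 := (ContinuousMultilinearMap.compContinuousLinearMapContinuousMultilinear ℂ
      (fun _ : Fin n => ℂ × ℂ) (fun _ : Fin n => ℂ × ℂ) ℂ).cont
    have h2 := h1.comp (continuous_pi fun _ : Fin n => continuous_R)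
    exact h2.clm_apply continuous_const
  have hFn : ∀ n, ∀ t ∈ Set.uIoc 0 (2 * Real.pi), ‖F n t‖ ≤ C * ‖p n‖ := fun n t ht => by
    rw [norm_smul]
    refine mul_le_mul (hC' t ht) ?_ (norm_nonneg _) hC0
    refine (ContinuousMultilinearMap.norm_compContinuousLinearMap_le _ _).trans ?_
    refine mul_le_of_le_one_right (norm_nonneg _) ?_
    exact Finset.prod_le_one (fun _ _ => norm_nonneg _) fun _ _ => norm_R_le t
  let q : FormalMultilinearSeries ℂ (ℂ × ℂ) ℂ := fun n => ∫ t in (0 : ℝ)..(2 * Real.pi), F n t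
  have hq : ∀ n, ‖q n‖ ≤ C * ‖p n‖ * (2 * Real.pi) := fun n => by
    have := intervalIntegral.norm_integral_le_of_norm_le_const (hFn n)
    rwa [sub_zero, abs_of_nonneg hpi] at this
  refine ⟨q, r, ⟨?_, hp.r_pos, ?_⟩⟩
  · refine hp.r_le.trans ?_
    refine ENNReal.le_of_forall_nnreal_lt fun s hs => ?_
    obtain ⟨M, hM, hM'⟩ := p.norm_mul_pow_le_of_lt_radius hs
    refine q.le_radius_of_bound (C * (2 * Real.pi) * M) fun n => ?_
    calc ‖q n‖ * (s : ℝ) ^ n ≤ C * ‖p n‖ * (2 * Real.pi) * (s : ℝ) ^ n := by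
          gcongr; exact hq n
      _ = C * (2 * Real.pi) * (‖p n‖ * (s : ℝ) ^ n) := by ring
      _ ≤ _ := by gcongr; exact hM' n
  · intro y hy
    have hqy : ∀ n, q n (fun _ => y) = ∫ t in (0 : ℝ)..(2 * Real.pi), w t * p n (fun _ => R t y) := by
      intro n
      have h1 : q n (fun _ => y) = ∫ t in (0 : ℝ)..(2 * Real.pi), F n t (fun _ => y) :=
        integral_apply (hF n) 0 (2 * Real.pi) (fun _ => y)
      rw [h1]
      rfl
    simp only [hqy, zero_add]
    have hs : Summable fun n => ‖p n‖ * ‖y‖ ^ n := by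
      have : ((‖y‖₊ : NNReal) : ENNReal) < p.radius := by
        refine lt_of_lt_of_le ?_ hp.r_le
        rwa [Metric.mem_eball, edist_zero_right, enorm_eq_nnnorm] at hy
      exact p.summable_norm_mul_pow this
    refine intervalIntegral.hasSum_integral_of_dominated_convergence
      (fun n _ => C * (‖p n‖ * ‖y‖ ^ n)) ?_ ?_ ?_ ?_ ?_
    · intro n
      refine Continuous.aestronglyMeasurable ?_
      refine hw.mul ((p n).cont.comp (continuous_pi fun _ => ?_))
      exact continuous_R.clm_apply continuous_const
    · intro n
      refine Eventually.of_forall fun t ht => ?_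
      rw [norm_mul]
      refine mul_le_mul (hC' t ht) ?_ (norm_nonneg _) hC0
      refine ((p n).le_opNorm _).trans ?_
      simp [norm_R_apply]
    · exact Eventually.of_forall fun t ht => hs.mul_left C
    · exact intervalIntegrable_const
    · refine Eventually.of_forall fun t ht => ?_
      have := hp.hasSum (y := R t y) (R_mem t hy)
      rw [zero_add] at this
      exact this.mul_left _

lemma E_eq_of_hasDerivAt {b : ℂ × ℂ → ℂ} {z : ℂ × ℂ} (hb : DifferentiableAt ℂ b z) {c : ℂ}
    (h : HasDerivAt (fun t : ℝ => b (R t z)) c 0) : E b z = -Complex.I * c := by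
  have hR : HasDerivAt (fun t : ℝ => R t z) (Complex.I * z.1, -Complex.I * z.2) 0 := by
    simp only [R_apply]
    have h0 : HasDerivAt (fun t : ℝ => (t : ℂ) * Complex.I) Complex.I 0 := by
      simpa using (Complex.ofRealCLM.hasDerivAt (x := 0)).mul_const Complex.I
    refine HasDerivAt.prodMk ?_ ?_
    · simpa using (h0.cexp.mul_const z.1)
    · simpa using (h0.fun_neg.cexp.mul_const z.2)
  have hz : R 0 z = z := by simp [R_apply]
  have hb' : HasFDerivAt b ((fderiv ℂ b z).restrictScalars ℝ) (R 0 z) := by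
    rw [hz]; exact hb.hasFDerivAt.restrictScalars ℝ
  have h1 := hb'.comp_hasDerivAt (0 : ℝ) hR
  have h2 := h.unique h1
  have e1 : deriv (fun w => b (w, z.2)) z.1 = fderiv ℂ b z (1, 0) := by
    have : HasDerivAt (fun w : ℂ => (w, z.2)) ((1 : ℂ), (0 : ℂ)) z.1 :=
      (hasDerivAt_id _).prodMk (hasDerivAt_const _ _)
    exact (HasFDerivAt.comp_hasDerivAt (l := b) z.1 (f := fun w : ℂ => (w, z.2)) hb.hasFDerivAt this).deriv
  have e2 : deriv (fun w => b (z.1, w)) z.2 = fderiv ℂ b z (0, 1) := by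
    have : HasDerivAt (fun w : ℂ => (z.1, w)) ((0 : ℂ), (1 : ℂ)) z.2 :=
      (hasDerivAt_const _ _).prodMk (hasDerivAt_id _)
    exact (HasFDerivAt.comp_hasDerivAt (l := b) z.2 (f := fun w : ℂ => (z.1, w)) hb.hasFDerivAt this).deriv
  have e3 : ((Complex.I * z.1, -Complex.I * z.2) : ℂ × ℂ) =
      (Complex.I * z.1) • ((1 : ℂ), (0 : ℂ)) + (-Complex.I * z.2) • ((0 : ℂ), (1 : ℂ)) := by
    simp
  rw [h2, E, e1, e2, ContinuousLinearMap.coe_restrictScalars', e3, map_add, map_smul, map_smul,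
    smul_eq_mul, smul_eq_mul]
  linear_combination ((z.1 * fderiv ℂ b z (1, 0)) - z.2 * fderiv ℂ b z (0, 1)) * Complex.I_mul_I

theorem decomp (a : ℂ × ℂ → ℂ) (ha : AnalyticAt ℂ a 0) :
    ∃ a0 b : ℂ × ℂ → ℂ, AnalyticAt ℂ a0 0 ∧ AnalyticAt ℂ b 0 ∧ E a0 =ᶠ[nhds 0] 0 ∧
      a0 + E b =ᶠ[nhds 0] a := by
  have hπ : (Real.pi : ℂ) ≠ 0 := by exact_mod_cast Real.pi_ne_zero
  have h1 : AnalyticAt ℂ (Av (fun _ => (2 * Real.pi : ℂ)⁻¹) a) 0 :=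
    Av_analytic continuous_const ha
  have h2 : AnalyticAt ℂ (Av (fun t => Complex.I * (2 * Real.pi : ℂ)⁻¹ * t) a) 0 :=
    Av_analytic (by fun_prop) ha
  have hcont : ∀ᶠ z in nhds (0 : ℂ × ℂ), Continuous fun t : ℝ => a (R t z) := by
    obtain ⟨ε, hε, hball⟩ := Metric.eventually_nhds_iff_ball.1 ha.eventually_analyticAt
    filter_upwards [Metric.ball_mem_nhds _ hε] with z hz
    rw [continuous_iff_continuousAt]
    intro t
    have : ContinuousAt a (R t z) := (hball _ (by simpa [norm_R_apply] using hz)).continuousAt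
    exact ContinuousAt.comp (f := fun t => R t z) (g := a) this
      (continuous_R.clm_apply continuous_const).continuousAt
  have hper : ∀ z, Function.Periodic (fun t : ℝ => a (R t z)) (2 * Real.pi) := fun z t => by
    simp only [R_two_pi]
  refine ⟨_, _, h1, h2, ?_, ?_⟩
  · filter_upwards [h1.eventually_analyticAt, hcont] with z hz hc
    have : HasDerivAt (fun t : ℝ => Av (fun _ => (2 * Real.pi : ℂ)⁻¹) a (R t z)) 0 0 := by
      have e : (fun t : ℝ => Av (fun _ => (2 * Real.pi : ℂ)⁻¹) a (R t z)) =
          fun t => Av (fun _ => (2 * Real.pi : ℂ)⁻¹) a z := by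
        funext t
        simp only [Av, R_R, intervalIntegral.integral_const_mul]
        rw [intervalIntegral.integral_comp_add_right (fun s => a (R s z)), zero_add, add_comm _ t,
          (hper z).intervalIntegral_add_eq t 0, zero_add]
      rw [e]; exact hasDerivAt_const _ _
    rw [E_eq_of_hasDerivAt hz.differentiableAt this]
    simp
  · filter_upwards [h2.eventually_analyticAt, hcont] with z hz hc
    set φ : ℝ → ℂ := fun t => a (R t z) with hφ
    set J : ℂ := ∫ t in (0 : ℝ)..(2 * Real.pi), φ t with hJ
    have hsc : Continuous fun s : ℝ => (s : ℂ) * φ s := by fun_prop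
    have hd : HasDerivAt (fun t : ℝ => Av (fun t => Complex.I * (2 * Real.pi : ℂ)⁻¹ * t) a (R t z))
        (Complex.I * (2 * Real.pi : ℂ)⁻¹ * (2 * Real.pi * a z - J)) 0 := by
      have e : (fun t : ℝ => Av (fun t => Complex.I * (2 * Real.pi : ℂ)⁻¹ * t) a (R t z)) =
          fun t : ℝ => Complex.I * (2 * Real.pi : ℂ)⁻¹ *
            ((∫ s in (0 : ℝ)..(t + 2 * Real.pi), (s : ℂ) * φ s) -
             (∫ s in (0 : ℝ)..t, (s : ℂ) * φ s) - t * J) := by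
        funext t
        simp only [Av, R_R, mul_assoc, intervalIntegral.integral_const_mul]
        congr 2
        have e1 : ∀ s : ℝ, (s : ℂ) * a (R (s + t) z) =
            (fun u : ℝ => (u : ℂ) * φ u - t * φ u) (s + t) := fun s => by
          simp only [hφ]; push_cast; ring
        simp only [e1]
        rw [intervalIntegral.integral_comp_add_right
            (fun u : ℝ => (u : ℂ) * φ u - t * φ u), zero_add, add_comm _ t,
          intervalIntegral.integral_sub (hsc.intervalIntegrable _ _)
            ((hc.const_mul _).intervalIntegrable _ _),
          intervalIntegral.integral_const_mul, (hper z).intervalIntegral_add_eq t 0, zero_add,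
          intervalIntegral.integral_interval_sub_left (hsc.intervalIntegrable _ _)
            (hsc.intervalIntegrable _ _)]
      rw [e]
      refine HasDerivAt.const_mul _ ?_
      have d1 := fun x : ℝ => intervalIntegral.integral_hasDerivAt_right
        (hsc.intervalIntegrable 0 x) (hsc.stronglyMeasurableAtFilter _ _) hsc.continuousAt
      have d2 : HasDerivAt (fun t : ℝ => ∫ s in (0 : ℝ)..(t + 2 * Real.pi), (s : ℂ) * φ s) _ 0 :=
        HasDerivAt.comp_add_const 0 (2 * Real.pi) (d1 (0 + 2 * Real.pi))
      have d3 : HasDerivAt (fun t : ℝ => (t : ℂ) * J) J 0 := by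
        simpa using (Complex.ofRealCLM.hasDerivAt (x := 0)).mul_const J
      refine ((d2.sub (d1 0)).sub d3).congr_deriv ?_
      have p0 : φ (0 + 2 * Real.pi) = a z := by
        rw [hφ]; exact (hper z 0).trans (by simp [R_apply])
      rw [p0]
      push_cast
      ring
    rw [Pi.add_apply, E_eq_of_hasDerivAt hz.differentiableAt hd]
    have : Av (fun _ => (2 * Real.pi : ℂ)⁻¹) a z = (2 * Real.pi : ℂ)⁻¹ * J := by
      simp only [Av, intervalIntegral.integral_const_mul, hJ, hφ]
    rw [this]
    field_simp
    linear_combination (J - 2 * Real.pi * a z) * Complex.I_sq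

lemma P_mono (n : ℕ) : ∀ (i j : ℕ) (a : ℂ × ℂ → ℂ), i + j = n → AnalyticAt ℂ a 0 →
    P (mono i j a) := by
  induction n using Nat.strong_induction_on with
  | _ n ih =>
    intro i j a hn ha
    obtain ⟨a0, b, ha0, hb, he, hab⟩ := decomp a ha
    have p1 : P (mono (i - 1) j (-(i : ℂ) • b)) := by
      rcases i with _ | i
      · convert P.zero using 1
        funext k l
        simp [mono]
      · exact ih (i + j) (by omega) _ _ _ (by simp) hb.const_smul
    have p2 : P (mono i (j - 1) ((j : ℂ) • b)) := by
      rcases j with _ | j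
      · convert P.zero using 1
        funext k l
        simp [mono]
      · exact ih (i + j) (by omega) _ _ _ (by simp) hb.const_smul
    refine P.step (mono_adm i j hb) (((P_diag j i a0 ha0 he).add p1).add p2) fun k l => ?_
    rw [Dop_mono]
    filter_upwards [hab] with z hz
    simp only [mono, Pi.add_apply] at hz ⊢
    have r1 : ((if k = i - 1 ∧ l = j then -(i : ℂ) • b else 0) : ℂ × ℂ → ℂ) z
        = - (if k = i - 1 ∧ l = j then (i : ℂ) • b else 0 : ℂ × ℂ → ℂ) z := by
      split_ifs <;> simp
    have r2 : ((if k = i ∧ l = j - 1 then -(j : ℂ) • b else 0) : ℂ × ℂ → ℂ) z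
        = - (if k = i ∧ l = j - 1 then (j : ℂ) • b else 0 : ℂ × ℂ → ℂ) z := by
      split_ifs <;> simp
    rw [r1, r2]
    by_cases h : k = i ∧ l = j
    · simp only [h, and_self, if_true, ← hz]; ring
    · simp only [h, if_false, Pi.zero_apply]; ring

lemma P_sum {ι : Type*} (s : Finset ι) (f : ι → ℕ → ℕ → ℂ × ℂ → ℂ) (hf : ∀ i ∈ s, P (f i)) :
    P (∑ i ∈ s, f i) := by
  classical
  induction s using Finset.induction_on with
  | empty => simpa using P.zero
  | insert i s hi ih =>
    rw [Finset.sum_insert hi]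
    exact (hf i (by simp)).add (ih fun j hj => hf j (by simp [hj]))

end RLP

/-- Relative log Poincaré lemma for `f(x₁,x₂) = x₁x₂`, surjectivity: the relative
logarithmic differential
`D(g) = ∑ (x₁∂₁g_{k₁,k₂} - x₂∂₂g_{k₁,k₂} + (k₁+1)g_{k₁+1,k₂} - (k₂+1)g_{k₁,k₂+1}) T₁^{k₁}T₂^{k₂}`
(with `T_i = log x_i` and coefficients holomorphic germs at `0 ∈ ℂ²`) is surjective. -/
theorem relative_log_poincare_surjective (h : ℕ → ℕ → ℂ × ℂ → ℂ)
    (hfin : ∃ N, ∀ k₁ k₂, N ≤ k₁ ∨ N ≤ k₂ → h k₁ k₂ = 0)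
    (han : ∀ k₁ k₂, AnalyticAt ℂ (h k₁ k₂) 0) :
    ∃ g : ℕ → ℕ → ℂ × ℂ → ℂ,
      (∃ N, ∀ k₁ k₂, N ≤ k₁ ∨ N ≤ k₂ → g k₁ k₂ = 0) ∧
      (∀ k₁ k₂, AnalyticAt ℂ (g k₁ k₂) 0) ∧
      (∀ k₁ k₂,
        (fun z : ℂ × ℂ =>
            z.1 * deriv (fun w => g k₁ k₂ (w, z.2)) z.1
              - z.2 * deriv (fun w => g k₁ k₂ (z.1, w)) z.2
              + ((k₁ : ℂ) + 1) * g (k₁ + 1) k₂ z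
              - ((k₂ : ℂ) + 1) * g k₁ (k₂ + 1) z)
          =ᶠ[nhds (0 : ℂ × ℂ)] h k₁ k₂) := by
  obtain ⟨N, hN⟩ := hfin
  have key : RLP.P h := by
    have : h = ∑ p ∈ Finset.range N ×ˢ Finset.range N, RLP.mono p.1 p.2 (h p.1 p.2) := by
      funext k l
      rw [Finset.sum_apply, Finset.sum_apply]
      by_cases hkl : N ≤ k ∨ N ≤ l
      · rw [hN k l hkl, Finset.sum_eq_zero]
        intro p hp
        simp only [Finset.mem_product, Finset.mem_range] at hp
        rw [RLP.mono, if_neg (by omega)]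
      · rw [Finset.sum_eq_single (k, l)]
        · simp [RLP.mono]
        · intro p _ hp
          rw [RLP.mono, if_neg]
          rintro ⟨rfl, rfl⟩
          exact hp rfl
        · intro hp
          simp only [Finset.mem_product, Finset.mem_range] at hp
          omega
    rw [this]
    exact RLP.P_sum _ _ fun p _ => RLP.P_mono _ _ _ _ rfl (han _ _)
  obtain ⟨g, hg, e⟩ := key
  exact ⟨g, hg.1, hg.2, e⟩
end
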